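/- Let σ be a primitive, non-erasing, well-marked substitution over 𝔸 = {a,b} whose fixed point ξ is recurrent and not ultimately periodic, with A·B ≠ B·A and W_0, T as in the context. Then: (i) if W is a strong right special factor of ξ (i.e. aWa, aWb, bWa, bWb are all factors of ξ), then T(W) is a strong right special factor of ξ; and (ii) there exists L ∈ ℕ such that every strong right special factor W of ξ with |W| ≥ L satisfies W = T(U) for a unique strong right special factor U of ξ. -/

import Mathlib

namespace Subst

/-- `pow A m` is the `m`-fold concatenation `A^m`. -/
def pow (A : List Bool) : ℕ → List Bool
  | 0 => []
  | n + 1 => pow A n ++ A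

/-- Membership in the submonoid of `𝔸*` generated by `{A, B}`. -/
inductive GenAB (A B : List Bool) : List Bool → Prop
  | nil : GenAB A B []
  | appA : ∀ {W}, GenAB A B W → GenAB A B (W ++ A)
  | appB : ∀ {W}, GenAB A B W → GenAB A B (W ++ B)

/-- The extension of a substitution `σ : 𝔸 → 𝔸*` to a monoid morphism of `𝔸*`. -/
def subst (σ : Bool → List Bool) : List Bool → List Bool
  | [] => []
  | c :: w => σ c ++ subst σ w

/-- The factor `ξ[i, i+n)` of the infinite sequence `ξ`. -/
def wordAt (ξ : ℕ → Bool) (i n : ℕ) : List Bool :=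
  (List.range n).map fun k => ξ (i + k)

/-- `W` is a factor of the infinite sequence `ξ`. -/
def IsFactor (ξ : ℕ → Bool) (W : List Bool) : Prop :=
  ∃ i, W = wordAt ξ i W.length

/-- `ξ` is a fixed point of `σ`: for every `n`, `σ(ξ[0,n))` is a prefix of `ξ`. -/
def IsFixedPoint (σ : Bool → List Bool) (ξ : ℕ → Bool) : Prop :=
  ∀ n, subst σ (wordAt ξ 0 n) = wordAt ξ 0 (subst σ (wordAt ξ 0 n)).length

/-- `ξ` is recurrent: every factor occurs at infinitely many positions. -/
def Recurrent (ξ : ℕ → Bool) : Prop :=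
  ∀ W, IsFactor ξ W → ∀ N, ∃ i, N ≤ i ∧ W = wordAt ξ i W.length

/-- `ξ` is ultimately periodic. -/
def UltPeriodic (ξ : ℕ → Bool) : Prop :=
  ∃ p, 1 ≤ p ∧ ∃ N, ∀ n, N ≤ n → ξ (n + p) = ξ n

/-- `σ` is non-erasing: the image of each letter is nonempty. -/
def NonErasing (σ : Bool → List Bool) : Prop := ∀ c, σ c ≠ []

/-- `σ` is well-marked: `σ(c)` begins with the letter `c` for each letter `c`. -/
def WellMarked (σ : Bool → List Bool) : Prop := ∀ c, ∃ t, σ c = c :: t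

/-- `σ` is primitive: for some `n ≥ 1`, each letter occurs in `σⁿ(d)` for each letter `d`. -/
def Primitive (σ : Bool → List Bool) : Prop :=
  ∃ n, 1 ≤ n ∧ ∀ c d : Bool, c ∈ (subst σ)^[n] [d]

/-- `W` is a right special factor of `ξ`: both `Wa` and `Wb` are factors of `ξ`. -/
def RightSpecial (ξ : ℕ → Bool) (W : List Bool) : Prop :=
  ∀ c : Bool, IsFactor ξ (W ++ [c])

/-- `W` is a left special factor of `ξ`: both `aW` and `bW` are factors of `ξ`. -/
def LeftSpecial (ξ : ℕ → Bool) (W : List Bool) : Prop :=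
  ∀ c : Bool, IsFactor ξ (c :: W)

/-- A right special factor is strong if all of `aWa, aWb, bWa, bWb` are factors. -/
def StrongSpecial (ξ : ℕ → Bool) (W : List Bool) : Prop :=
  ∀ c d : Bool, IsFactor ξ (c :: (W ++ [d]))

/-- A right special factor is weak if neither `aW` nor `bW` is right special. -/
def WeakSpecial (ξ : ℕ → Bool) (W : List Bool) : Prop :=
  RightSpecial ξ W ∧ ∀ c : Bool, ¬ RightSpecial ξ (c :: W)

/-- The operator `T(W) = W₀ · σ(W)`. -/
def T (σ : Bool → List Bool) (W0 W : List Bool) : List Bool := W0 ++ subst σ W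

/-- Specification of the word `W₀` (the longest common suffix of `A^∞` and `B^∞`)
together with the distinct letters `δ_a, δ_b`:  `δ_c · W₀` is a suffix of some power
of `σ(c)` for each letter `c`, and `δ_a ≠ δ_b`. -/
def W0Spec (σ : Bool → List Bool) (W0 : List Bool) (δ : Bool → Bool) : Prop :=
  δ false ≠ δ true ∧ ∀ c, ∃ m, 1 ≤ m ∧ (δ c :: W0) <:+ pow (σ c) m

/-- The incidence matrix of `σ`: its columns are the Parikh vectors of `σ(a)` and `σ(b)`. -/
def incMat (σ : Bool → List Bool) : Matrix Bool Bool ℤ :=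
  Matrix.of fun c d => ((σ d).count c : ℤ)

end Subst

namespace Subst

section Words

variable {σ : Bool → List Bool}

theorem subst_append (u v : List Bool) : subst σ (u ++ v) = subst σ u ++ subst σ v := by
  induction u with
  | nil => rfl
  | cons c u ih => simp [subst, ih]

theorem subst_singleton (c : Bool) : subst σ [c] = σ c := by simp [subst]

theorem subst_injective (hwm : WellMarked σ) : Function.Injective (subst σ) := by
  intro u
  induction u with
  | nil =>
    intro v h
    cases v with
    | nil => rfl
    | cons d v =>
      obtain ⟨t, ht⟩ := hwm d
      simp [subst, ht] at h
  | cons c u ih =>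
    intro v h
    obtain ⟨t, ht⟩ := hwm c
    cases v with
    | nil => simp [subst, ht] at h
    | cons d v =>
      obtain ⟨s, hs⟩ := hwm d
      have hcd : c = d := by
        simp only [subst, ht, hs, List.cons_append, List.cons.injEq] at h
        exact h.1
      subst hcd
      rw [ih (List.append_cancel_left h)]

theorem length_le_length_subst (hne : NonErasing σ) (u : List Bool) :
    u.length ≤ (subst σ u).length := by
  induction u with
  | nil => simp
  | cons c u ih =>
    have := List.length_pos_of_ne_nil (hne c)
    simp [subst]
    omega

theorem pow_succ_eq (A : List Bool) (m : ℕ) : pow A (m + 1) = pow A m ++ A := rfl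

theorem cons_suffix_append_image {W0 : List Bool} {δ : Bool → Bool} (hne : NonErasing σ)
    (hW0 : W0Spec σ W0 δ) (c : Bool) : (δ c :: W0) <:+ W0 ++ σ c := by
  obtain ⟨m, -, hm⟩ := hW0.2 c
  have hpos := List.length_pos_of_ne_nil (hne c)
  have hshift : W0 ++ σ c <:+ pow (σ c) (m + 1) := by
    obtain ⟨t, ht⟩ := (List.suffix_cons (δ c) W0).trans hm
    exact ⟨t, by rw [pow_succ_eq, ← ht, List.append_assoc]⟩
  have hlong : (δ c :: W0) <:+ pow (σ c) (m + 1) := by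
    cases m with
    | zero => simp [pow] at hm
    | succ k =>
      have hk : ∀ n, pow (σ c) (n + 1) = σ c ++ pow (σ c) n := by
        intro n
        induction n with
        | zero => simp [pow]
        | succ n ih => rw [pow_succ_eq, ih, List.append_assoc, ← pow_succ_eq, ih]
      rw [hk]
      exact hm.trans (List.suffix_append _ _)
  exact List.suffix_of_suffix_length_le hlong hshift (by simp; omega)

theorem suffix_append_subst {W0 : List Bool} {δ : Bool → Bool} (hne : NonErasing σ)
    (hW0 : W0Spec σ W0 δ) (u : List Bool) : W0 <:+ W0 ++ subst σ u := by
  induction u using List.reverseRecOn with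
  | nil => simp [subst]
  | append_singleton u c ih =>
    obtain ⟨t, ht⟩ := ih
    rw [subst_append, subst_singleton, ← List.append_assoc, ← ht, List.append_assoc]
    exact ((List.suffix_cons (δ c) W0).trans (cons_suffix_append_image hne hW0 c)).trans
      (List.suffix_append _ _)

theorem cons_suffix_append_subst {W0 : List Bool} {δ : Bool → Bool} (hne : NonErasing σ)
    (hW0 : W0Spec σ W0 δ) (u : List Bool) (c : Bool) (v : List Bool) :
    (δ c :: T σ W0 v) <:+ W0 ++ subst σ (u ++ c :: v) := by
  obtain ⟨t, ht⟩ := suffix_append_subst hne hW0 u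
  obtain ⟨s, hs⟩ := cons_suffix_append_image hne hW0 c
  refine ⟨t ++ s, ?_⟩
  rw [subst_append, ← List.append_assoc, ← ht]
  simp only [subst, T]
  rw [List.append_assoc t W0, ← List.append_assoc W0, ← hs]
  simp

/-- Two words have only one longest common suffix. -/
theorem common_suffix_unique {V W P Q : List Bool} {x y c d : Bool} (hxy : x ≠ y) (hcd : c ≠ d)
    (hxP : (x :: V) <:+ P) (hyQ : (y :: V) <:+ Q) (hcP : (c :: W) <:+ P)
    (hdQ : (d :: W) <:+ Q) : V = W ∧ x = c := by
  have key : ∀ {V W : List Bool} {x y c d : Bool}, x ≠ y → (x :: V) <:+ P → (y :: V) <:+ Q →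
      (c :: W) <:+ P → (d :: W) <:+ Q → ¬ V.length < W.length := by
    intro V W x y c d hxy hxP hyQ hcP hdQ hlt
    have h1 : (x :: V) <:+ W :=
      List.suffix_of_suffix_length_le hxP ((List.suffix_cons c W).trans hcP) (by simp; omega)
    have h2 : (y :: V) <:+ W :=
      List.suffix_of_suffix_length_le hyQ ((List.suffix_cons d W).trans hdQ) (by simp; omega)
    have h3 := (List.suffix_of_suffix_length_le h1 h2 (by simp)).eq_of_length (by simp)
    simp at h3
    exact hxy h3
  have hlen : V.length = W.length := by
    have h1 := key hxy hxP hyQ hcP hdQ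
    have h2 := key hcd hcP hdQ hxP hyQ
    omega
  have h3 := (List.suffix_of_suffix_length_le hxP hcP (by simp [hlen])).eq_of_length
    (by simp [hlen])
  simp at h3
  exact ⟨h3.2, h3.1⟩

/-- Two words, neither of which is a suffix of the other, differ just before their longest
common suffix. -/
theorem exists_common_suffix (u v : List Bool) (huv : ¬ u <:+ v) (hvu : ¬ v <:+ u) :
    ∃ u' v' x y w, x ≠ y ∧ u = u' ++ x :: w ∧ v = v' ++ y :: w := by
  induction u using List.reverseRecOn generalizing v with
  | nil => exact absurd (List.nil_suffix) huv
  | append_singleton u c ih =>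
    rcases List.eq_nil_or_concat' v with rfl | ⟨v, d, rfl⟩
    · exact absurd (List.nil_suffix) hvu
    by_cases hcd : c = d
    · subst hcd
      obtain ⟨u', v', x, y, w, hxy, rfl, rfl⟩ := ih v
        (fun ⟨t, ht⟩ => huv ⟨t, by rw [← ht, List.append_assoc]⟩)
        (fun ⟨t, ht⟩ => hvu ⟨t, by rw [← ht, List.append_assoc]⟩)
      exact ⟨u', v', x, y, w ++ [c], hxy, by simp, by simp⟩
    · exact ⟨u, v, c, d, [], hcd, rfl, rfl⟩

end Words

section Factors

variable {ξ : ℕ → Bool}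

@[simp] theorem length_wordAt (i n : ℕ) : (wordAt ξ i n).length = n := by simp [wordAt]

theorem wordAt_add (i m n : ℕ) : wordAt ξ i (m + n) = wordAt ξ i m ++ wordAt ξ (i + m) n := by
  simp [wordAt, List.range_add, Function.comp_def, add_assoc]

theorem wordAt_one (i : ℕ) : wordAt ξ i 1 = [ξ i] := by simp [wordAt]

theorem wordAt_succ (i n : ℕ) : wordAt ξ i (n + 1) = wordAt ξ i n ++ [ξ (i + n)] := by
  rw [wordAt_add, wordAt_one]

theorem wordAt_eq_iff {i j n : ℕ} :
    wordAt ξ i n = wordAt ξ j n ↔ ∀ k < n, ξ (i + k) = ξ (j + k) := by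
  simp [wordAt]

theorem append_eq_wordAt {u v : List Bool} {i n : ℕ} (h : u ++ v = wordAt ξ i n) :
    u = wordAt ξ i u.length ∧ v = wordAt ξ (i + u.length) v.length := by
  have hn : n = u.length + v.length := by
    have := congrArg List.length h
    simpa using this.symm
  rw [hn, wordAt_add] at h
  exact List.append_inj h (by simp)

theorem isFactor_wordAt (i n : ℕ) : IsFactor ξ (wordAt ξ i n) := ⟨i, by simp⟩

theorem IsFactor.mono {u v : List Bool} (hv : IsFactor ξ v) (h : u <:+: v) :
    IsFactor ξ u := by
  obtain ⟨s, t, rfl⟩ := h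
  obtain ⟨i, hi⟩ := hv
  exact ⟨_, (append_eq_wordAt (append_eq_wordAt hi).1).2⟩

theorem isFactor_image {σ : Bool → List Bool} (hfix : IsFixedPoint σ ξ) {u : List Bool}
    (hu : IsFactor ξ u) : IsFactor ξ (subst σ u) := by
  obtain ⟨i, hi⟩ := hu
  have hpre : IsFactor ξ (subst σ (wordAt ξ 0 (i + u.length))) := ⟨0, hfix _⟩
  rw [wordAt_add, zero_add, ← hi, subst_append] at hpre
  exact hpre.mono (List.suffix_append _ _).isInfix

theorem occurrence_of_cons_append {W : List Bool} {c d : Bool} {i : ℕ}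
    (h : c :: (W ++ [d]) = wordAt ξ i (c :: (W ++ [d])).length) :
    ξ i = c ∧ W = wordAt ξ (i + 1) W.length ∧ ξ (i + 1 + W.length) = d := by
  have h1 := append_eq_wordAt (u := [c]) h
  have h2 := append_eq_wordAt h1.2
  simp [wordAt_one] at h1 h2
  exact ⟨h1.1.symm, h2.1, h2.2.symm⟩

end Factors

/-- `T` maps strong right special factors to strong right special factors. -/
theorem StrongSpecial.image {σ : Bool → List Bool} (hne : NonErasing σ) (hwm : WellMarked σ)
    {W0 : List Bool} {δ : Bool → Bool} (hW0 : W0Spec σ W0 δ) {ξ : ℕ → Bool}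
    (hfix : IsFixedPoint σ ξ) (hrec : Recurrent ξ) {W : List Bool} (hW : StrongSpecial ξ W) :
    StrongSpecial ξ (T σ W0 W) := by
  intro c' d
  obtain ⟨c, rfl⟩ : ∃ c, δ c = c' := by
    have h := hW0.1
    by_contra! hc
    have h1 := hc false
    have h2 := hc true
    revert h h1 h2
    cases δ false <;> cases δ true <;> cases c' <;> simp
  obtain ⟨i, hi, hocc⟩ := hrec _ (hW c d) W0.length
  set u := wordAt ξ 0 i with hu
  have hlong : IsFactor ξ (u ++ c :: (W ++ [d])) := by
    have : u ++ c :: (W ++ [d]) = wordAt ξ 0 (i + (c :: (W ++ [d])).length) := by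
      rw [wordAt_add, zero_add, ← hocc]
    rw [this]
    exact isFactor_wordAt _ _
  have hfac := isFactor_image hfix hlong
  have hsuf : (δ c :: T σ W0 W) <:+ subst σ (u ++ c :: W) := by
    refine List.suffix_of_suffix_length_le (cons_suffix_append_subst hne hW0 u c W)
      (List.suffix_append _ _) ?_
    have h1 := length_le_length_subst hne u
    have h2 := List.length_pos_of_ne_nil (hne c)
    simp [T, subst_append, subst, hu] at h1 ⊢
    omega
  obtain ⟨t, ht⟩ := hwm d
  obtain ⟨s, hs⟩ := hsuf
  refine hfac.mono ⟨s, t, ?_⟩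
  have : u ++ c :: (W ++ [d]) = (u ++ c :: W) ++ [d] := by simp
  rw [this, subst_append, ← hs, subst_singleton, ht]
  simp

section Cuts

variable {σ : Bool → List Bool} {ξ : ℕ → Bool}

/-- The `n`-th cutting point: the position in `ξ` at which the block `σ(ξ(n))` starts. -/
def cut (σ : Bool → List Bool) (ξ : ℕ → Bool) (n : ℕ) : ℕ :=
  (subst σ (wordAt ξ 0 n)).length

theorem cut_zero : cut σ ξ 0 = 0 := by simp [cut, wordAt, subst]

theorem cut_succ (n : ℕ) : cut σ ξ (n + 1) = cut σ ξ n + (σ (ξ n)).length := by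
  simp [cut, wordAt_succ, subst_append, subst_singleton]

theorem subst_wordAt_zero (hfix : IsFixedPoint σ ξ) (n : ℕ) :
    subst σ (wordAt ξ 0 n) = wordAt ξ 0 (cut σ ξ n) := hfix n

theorem wordAt_cut (hfix : IsFixedPoint σ ξ) (n : ℕ) :
    wordAt ξ (cut σ ξ n) (σ (ξ n)).length = σ (ξ n) := by
  have h := subst_wordAt_zero hfix (n + 1)
  rw [wordAt_succ, subst_append, subst_singleton, zero_add] at h
  have := (append_eq_wordAt h).2
  rw [zero_add] at this
  exact this.symm

theorem apply_cut_add (hfix : IsFixedPoint σ ξ) {n o : ℕ} (ho : o < (σ (ξ n)).length) :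
    ξ (cut σ ξ n + o) = (σ (ξ n))[o] := by
  have h := wordAt_cut hfix n
  have h2 : (wordAt ξ (cut σ ξ n) (σ (ξ n)).length)[o]? = (σ (ξ n))[o]? := by rw [h]
  simpa [wordAt, ho] using h2

theorem apply_cut (hwm : WellMarked σ) (hfix : IsFixedPoint σ ξ) (n : ℕ) :
    ξ (cut σ ξ n) = ξ n := by
  obtain ⟨t, ht⟩ := hwm (ξ n)
  have h := apply_cut_add hfix (n := n) (o := 0) (by simp [ht])
  simpa [ht] using h

theorem cut_strictMono (hne : NonErasing σ) : StrictMono (cut σ ξ) :=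
  strictMono_nat_of_lt_succ fun n => by
    have := List.length_pos_of_ne_nil (hne (ξ n))
    rw [cut_succ]
    omega

theorem exists_block (hne : NonErasing σ) (p : ℕ) :
    ∃ r, cut σ ξ r ≤ p ∧ p < cut σ ξ (r + 1) := by
  induction p with
  | zero => exact ⟨0, by simp [cut_zero], by
      have := cut_strictMono (ξ := ξ) hne (Nat.lt_succ_self 0); simpa [cut_zero] using this⟩
  | succ p ih =>
    obtain ⟨r, h1, h2⟩ := ih
    by_cases h : p + 1 < cut σ ξ (r + 1)
    · exact ⟨r, by omega, h⟩
    · have := cut_strictMono (ξ := ξ) hne (Nat.lt_succ_self (r + 1))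
      exact ⟨r + 1, by omega, by simp at this; omega⟩

/-- Position `p` lies in a block `σ(c)`, at offset `o`. -/
def InBlock (σ : Bool → List Bool) (ξ : ℕ → Bool) (p : ℕ) (s : Bool × ℕ) : Prop :=
  s.2 < (σ s.1).length ∧ ∃ r, ξ r = s.1 ∧ p = cut σ ξ r + s.2

theorem exists_inBlock (hne : NonErasing σ) (p : ℕ) : ∃ s, InBlock σ ξ p s := by
  obtain ⟨r, h1, h2⟩ := exists_block (ξ := ξ) hne p
  rw [cut_succ] at h2
  exact ⟨(ξ r, p - cut σ ξ r), by simp; omega, r, rfl, by simp; omega⟩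

theorem InBlock.apply_eq (hfix : IsFixedPoint σ ξ) {p : ℕ} {s : Bool × ℕ}
    (h : InBlock σ ξ p s) : ξ p = (σ s.1)[s.2]'h.1 := by
  obtain ⟨c, o⟩ := s
  obtain ⟨ho, r, hr, rfl⟩ := h
  simp only at ho hr
  subst hr
  exact apply_cut_add hfix ho

theorem InBlock.succ {p : ℕ} {c : Bool} {o : ℕ} (h : InBlock σ ξ p (c, o))
    (ho : o + 1 < (σ c).length) : InBlock σ ξ (p + 1) (c, o + 1) := by
  obtain ⟨-, r, hr, rfl⟩ := h
  exact ⟨ho, r, hr, rfl⟩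

theorem InBlock.succ_mem_range {p : ℕ} {c : Bool} {o : ℕ} (h : InBlock σ ξ p (c, o))
    (ho : ¬ o + 1 < (σ c).length) : p + 1 ∈ Set.range (cut σ ξ) := by
  obtain ⟨h1, r, hr, rfl⟩ := h
  simp only at h1 hr
  exact ⟨r + 1, by rw [cut_succ, hr]; simp; omega⟩

theorem inBlock_of_mem_range (hne : NonErasing σ) (hwm : WellMarked σ)
    (hfix : IsFixedPoint σ ξ) {p : ℕ} (h : p ∈ Set.range (cut σ ξ)) :
    InBlock σ ξ p (ξ p, 0) := by
  obtain ⟨r, rfl⟩ := h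
  exact ⟨List.length_pos_of_ne_nil (hne _), r, (apply_cut hwm hfix r).symm, rfl⟩

/-- Between two simultaneous cuts, a pair of parsings of the same word evolves
deterministically. -/
theorem inBlock_pair_step (hne : NonErasing σ) (hwm : WellMarked σ) (hfix : IsFixedPoint σ ξ)
    {p q p' q' : ℕ} {s t : Bool × ℕ}
    (hp : InBlock σ ξ p s) (hq : InBlock σ ξ q t) (hp' : InBlock σ ξ p' s)
    (hq' : InBlock σ ξ q' t) (hpq : ξ (p + 1) = ξ (q + 1)) (hpq' : ξ (p' + 1) = ξ (q' + 1))
    (hns : ¬ (p + 1 ∈ Set.range (cut σ ξ) ∧ q + 1 ∈ Set.range (cut σ ξ))) :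
    ∃ s' t', InBlock σ ξ (p + 1) s' ∧ InBlock σ ξ (q + 1) t' ∧
      InBlock σ ξ (p' + 1) s' ∧ InBlock σ ξ (q' + 1) t' := by
  obtain ⟨c, o⟩ := s
  obtain ⟨d, e⟩ := t
  by_cases ho : o + 1 < (σ c).length <;> by_cases he : e + 1 < (σ d).length
  · exact ⟨_, _, hp.succ ho, hq.succ he, hp'.succ ho, hq'.succ he⟩
  · have hpp : ξ (p + 1) = ξ (p' + 1) := by
      rw [(hp.succ ho).apply_eq hfix, (hp'.succ ho).apply_eq hfix]
    have h2 := inBlock_of_mem_range hne hwm hfix (hq'.succ_mem_range he)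
    rw [← hpq', ← hpp, hpq] at h2
    exact ⟨_, _, hp.succ ho, inBlock_of_mem_range hne hwm hfix (hq.succ_mem_range he),
      hp'.succ ho, h2⟩
  · have hqq : ξ (q + 1) = ξ (q' + 1) := by
      rw [(hq.succ he).apply_eq hfix, (hq'.succ he).apply_eq hfix]
    have h2 := inBlock_of_mem_range hne hwm hfix (hp'.succ_mem_range ho)
    rw [hpq', ← hqq, ← hpq] at h2
    exact ⟨_, _, inBlock_of_mem_range hne hwm hfix (hp.succ_mem_range ho), hq.succ he,
      h2, hq'.succ he⟩
  · exact absurd ⟨hp.succ_mem_range ho, hq.succ_mem_range he⟩ hns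

/-- A word occurring at two places without a simultaneous cut is periodic with bounded period,
up to a bounded prefix. -/
theorem exists_period_of_no_common_cut (hne : NonErasing σ) (hwm : WellMarked σ)
    (hfix : IsFixedPoint σ ξ) :
    ∃ M : ℕ, ∀ L i j : ℕ, (∀ k < M + L, ξ (i + k) = ξ (j + k)) →
      (∀ k < M + L, ¬ (i + k ∈ Set.range (cut σ ξ) ∧ j + k ∈ Set.range (cut σ ξ))) →
      ∃ q p, 1 ≤ p ∧ p ≤ M ∧ ∀ t, t + p < L → ξ (q + t + p) = ξ (q + t) := by
  choose S hS using fun p => exists_inBlock (σ := σ) (ξ := ξ) hne p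
  set m := (σ false).length + (σ true).length with hm
  set F : Finset ((Bool × ℕ) × (Bool × ℕ)) :=
    (Finset.univ ×ˢ Finset.range m) ×ˢ (Finset.univ ×ˢ Finset.range m) with hF
  refine ⟨F.card, fun L i j heq hns => ?_⟩
  have hmem : ∀ p, S p ∈ (Finset.univ : Finset Bool) ×ˢ Finset.range m := by
    intro p
    have h1 := (hS p).1
    simp only [Finset.mem_product, Finset.mem_univ, Finset.mem_range, true_and]
    rcases hc : (S p).1 <;> rw [hc] at h1 <;> omega
  obtain ⟨k₁, hk₁, k₂, hk₂, hne', hpair⟩ :=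
    Finset.exists_ne_map_eq_of_card_lt_of_maps_to (s := Finset.range (F.card + 1)) (t := F)
      (by simp) (f := fun k => (S (i + k), S (j + k)))
      (fun k _ => Finset.mem_product.2 ⟨hmem _, hmem _⟩)
  wlog hlt : k₁ < k₂ generalizing k₁ k₂
  · exact this k₂ hk₂ k₁ hk₁ hne'.symm hpair.symm (by omega)
  simp only [Finset.mem_range] at hk₁ hk₂
  simp only [Prod.mk.injEq] at hpair
  have hstate : ∀ t, k₂ + t < F.card + L → ∃ s s', InBlock σ ξ (i + k₁ + t) s ∧
      InBlock σ ξ (j + k₁ + t) s' ∧ InBlock σ ξ (i + k₂ + t) s ∧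
      InBlock σ ξ (j + k₂ + t) s' := by
    intro t
    induction t with
    | zero =>
      intro _
      exact ⟨_, _, hS _, hS _, by simpa [hpair.1] using hS (i + k₂),
        by simpa [hpair.2] using hS (j + k₂)⟩
    | succ t ih =>
      intro ht
      obtain ⟨s, s', h1, h2, h3, h4⟩ := ih (by omega)
      have e1 := heq (k₁ + t + 1) (by omega)
      have e2 := heq (k₂ + t + 1) (by omega)
      have e3 := hns (k₁ + t + 1) (by omega)
      simp only [← add_assoc] at e1 e2 e3 ⊢
      exact inBlock_pair_step hne hwm hfix h1 h2 h3 h4 e1 e2 e3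
  refine ⟨i + k₁, k₂ - k₁, by omega, by omega, fun t ht => ?_⟩
  obtain ⟨s, -, h1, -, h3, -⟩ := hstate t (by omega)
  rw [h1.apply_eq hfix, ← h3.apply_eq hfix]
  congr 1
  omega

/-- Past a simultaneous cut, two parsings of the same word agree up to any place where
the continuations differ. -/
theorem mem_range_cut_of_common_cut (hne : NonErasing σ) (hwm : WellMarked σ)
    (hfix : IsFixedPoint σ ξ) {i j n k : ℕ} (hkn : k ≤ n)
    (heq : ∀ k < n, ξ (i + k) = ξ (j + k)) (hdiff : ξ (i + n) ≠ ξ (j + n))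
    (hi : i + k ∈ Set.range (cut σ ξ)) (hj : j + k ∈ Set.range (cut σ ξ)) :
    i + n ∈ Set.range (cut σ ξ) := by
  induction hd : n - k using Nat.strong_induction_on generalizing k with
  | _ d ih =>
    rcases hkn.eq_or_lt with rfl | hlt
    · exact hi
    obtain ⟨r, hr⟩ := hi
    obtain ⟨s, hs⟩ := hj
    have hrs : ξ r = ξ s := by
      rw [← apply_cut hwm hfix r, ← apply_cut hwm hfix s, hr, hs, heq k hlt]
    have hpos := List.length_pos_of_ne_nil (hne (ξ r))
    by_cases hlen : k + (σ (ξ r)).length ≤ n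
    · exact ih (n - (k + (σ (ξ r)).length)) (by omega) hlen
        ⟨r + 1, by rw [cut_succ, hr, add_assoc]⟩ ⟨s + 1, by rw [cut_succ, hs, hrs, add_assoc]⟩ rfl
    · refine absurd ?_ hdiff
      have h1 := apply_cut_add hfix (n := r) (o := n - k) (by omega)
      have h2 := apply_cut_add hfix (n := s) (o := n - k) (by rw [← hrs]; omega)
      rw [hr, add_assoc, Nat.add_sub_cancel' hkn] at h1
      rw [hs, add_assoc, Nat.add_sub_cancel' hkn] at h2
      rw [h1, h2]
      simp only [hrs]

end Cuts

section Recurrence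

variable {σ : Bool → List Bool} {ξ : ℕ → Bool}

/-- Every letter occurs in the image of every other letter. -/
theorem mem_image_of_ne (hprim : Primitive σ) {c d : Bool} (hcd : c ≠ d) : c ∈ σ d := by
  by_contra hc
  obtain ⟨n, -, hn⟩ := hprim
  have key : ∀ m (u : List Bool), c ∉ u → c ∉ (subst σ)^[m] u := by
    intro m
    induction m with
    | zero => exact fun u hu => hu
    | succ m ih =>
      intro u hu
      rw [Function.iterate_succ_apply]
      refine ih _ ?_
      clear ih
      induction u with
      | nil => simp [subst]
      | cons x u ihu =>
        simp only [List.mem_cons, not_or] at hu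
        have hx : x = d := by
          have := hu.1
          revert this hcd
          cases x <;> cases c <;> cases d <;> simp
        simp only [subst, List.mem_append, not_or]
        exact ⟨hx ▸ hc, ihu hu.2⟩
  exact key n [d] (by simpa using hcd) (hn c d)

theorem two_le_length_image (hwm : WellMarked σ) (hprim : Primitive σ) (d : Bool) :
    2 ≤ (σ d).length := by
  obtain ⟨t, ht⟩ := hwm d
  have h := mem_image_of_ne hprim (c := !d) (d := d) (by simp)
  rw [ht] at h ⊢
  cases t with
  | nil => simp at h
  | cons x t => simp

theorem apply_cut_add_of_occurrence (hfix : IsFixedPoint σ ξ) {N r : ℕ}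
    (h : ∀ k < N, ξ (r + k) = ξ k) : ∀ k < cut σ ξ N, ξ (cut σ ξ r + k) = ξ k := by
  have h1 : wordAt ξ r N = wordAt ξ 0 N := wordAt_eq_iff.2 (by simpa using h)
  have h2 := subst_wordAt_zero hfix (r + N)
  rw [wordAt_add, zero_add, subst_append, h1, subst_wordAt_zero hfix r,
    subst_wordAt_zero hfix N] at h2
  have h3 := (append_eq_wordAt h2).2
  simp only [length_wordAt, zero_add] at h3
  simpa using wordAt_eq_iff.1 h3.symm

theorem cut_le_cut_add (σ : Bool → List Bool) (ξ : ℕ → Bool) (q n : ℕ) :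
    cut σ ξ (q + n) ≤ cut σ ξ q + n * ((σ false).length + (σ true).length) := by
  induction n with
  | zero => simp
  | succ n ih =>
    rw [← add_assoc, cut_succ, add_mul]
    rcases ξ (q + n) <;> omega

/-- Every prefix of `ξ` occurs with bounded gaps. -/
theorem prefix_bounded_gaps (hne : NonErasing σ) (hwm : WellMarked σ) (hprim : Primitive σ)
    (hfix : IsFixedPoint σ ξ) (N : ℕ) :
    ∃ R, ∀ q, ∃ r, q ≤ r ∧ r ≤ q + R ∧ ∀ k < N, ξ (r + k) = ξ k := by
  set m := (σ false).length + (σ true).length with hm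
  induction N with
  | zero => exact ⟨0, fun q => ⟨q, le_rfl, le_rfl, by simp⟩⟩
  | succ N ih =>
    rcases Nat.eq_zero_or_pos N with rfl | hN
    · refine ⟨2 * m, fun q => ?_⟩
      obtain ⟨b, h1, h2⟩ := exists_block (ξ := ξ) hne q
      have hmem : ξ 0 ∈ σ (ξ (b + 1)) := by
        by_cases h : ξ 0 = ξ (b + 1)
        · obtain ⟨t, ht⟩ := hwm (ξ (b + 1))
          rw [h, ht]
          simp
        · exact mem_image_of_ne hprim h
      obtain ⟨o, ho, hoe⟩ := List.mem_iff_getElem.1 hmem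
      have h3 := apply_cut_add hfix ho
      have h4 := cut_le_cut_add σ ξ b 2
      have h5 := cut_succ (σ := σ) (ξ := ξ) (b + 1)
      rw [show b + 1 + 1 = b + 2 from rfl] at h5
      refine ⟨cut σ ξ (b + 1) + o, by omega, by omega, ?_⟩
      intro k hk
      obtain rfl : k = 0 := by omega
      rw [add_zero, h3, hoe]
    · obtain ⟨R, hR⟩ := ih
      refine ⟨(R + 1) * m, fun q => ?_⟩
      obtain ⟨b, h1, h2⟩ := exists_block (ξ := ξ) hne q
      obtain ⟨r, hr1, hr2, hr3⟩ := hR (b + 1)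
      have hmono := (cut_strictMono (ξ := ξ) hne).monotone
      have h3 := hmono hr1
      have h4 := hmono hr2
      have h5 := cut_le_cut_add σ ξ b (1 + R)
      rw [← add_assoc, add_comm 1 R, ← hm] at h5
      refine ⟨cut σ ξ r, by omega, by omega, fun k hk => ?_⟩
      refine apply_cut_add_of_occurrence hfix hr3 k (lt_of_lt_of_le hk ?_)
      obtain ⟨n, rfl⟩ : ∃ n, N = n + 1 := ⟨N - 1, by omega⟩
      have h6 := (cut_strictMono (ξ := ξ) hne).id_le n
      have h7 := two_le_length_image hwm hprim (ξ n)
      rw [cut_succ]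
      simp only [id] at h6
      omega

/-- Factors of bounded period have bounded length. -/
theorem exists_bound_of_period (hne : NonErasing σ) (hwm : WellMarked σ) (hprim : Primitive σ)
    (hfix : IsFixedPoint σ ξ) (hnp : ¬ UltPeriodic ξ) (M : ℕ) :
    ∃ L, ∀ q p, 1 ≤ p → p ≤ M → ¬ ∀ t, t + p < L → ξ (q + t + p) = ξ (q + t) := by
  have hex : ∀ p, ∃ n, 1 ≤ p → ξ (n + p) ≠ ξ n := by
    intro p
    by_contra! h
    exact hnp ⟨p, (h 0).1, 0, fun n _ => (h n).2⟩
  choose n hn using hex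
  set K := ∑ p ∈ Finset.range (M + 1), n p with hK
  obtain ⟨R, hR⟩ := prefix_bounded_gaps hne hwm hprim hfix (K + M + 1)
  refine ⟨R + K + M + 1, fun q p hp hpM hper => ?_⟩
  have hnK : n p ≤ K :=
    Finset.single_le_sum (f := n) (fun _ _ => Nat.zero_le _) (Finset.mem_range.2 (by omega))
  obtain ⟨r, h1, h2, h3⟩ := hR q
  refine hn p hp ?_
  have h4 := hper (r - q + n p) (by omega)
  rw [← h3 (n p + p) (by omega), ← h3 (n p) (by omega)]
  convert h4 using 2 <;> omega

end Recurrence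

/-- Two occurrences of a long word have a simultaneous cut. -/
theorem exists_common_cut {σ : Bool → List Bool} {ξ : ℕ → Bool} (hne : NonErasing σ)
    (hwm : WellMarked σ) (hprim : Primitive σ) (hfix : IsFixedPoint σ ξ)
    (hnp : ¬ UltPeriodic ξ) :
    ∃ L, ∀ i j, (∀ k < L, ξ (i + k) = ξ (j + k)) →
      ∃ k < L, i + k ∈ Set.range (cut σ ξ) ∧ j + k ∈ Set.range (cut σ ξ) := by
  obtain ⟨M, hM⟩ := exists_period_of_no_common_cut hne hwm hfix
  obtain ⟨L, hL⟩ := exists_bound_of_period hne hwm hprim hfix hnp M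
  refine ⟨M + L, fun i j heq => ?_⟩
  by_contra! hns
  obtain ⟨q, p, hp, hpM, hper⟩ := hM L i j heq (fun k hk h => hns k hk h.1 h.2)
  exact hL q p hp hpM hper

/-- A long strong right special factor is only followed by cuts. -/
theorem StrongSpecial.exists_cut {σ : Bool → List Bool} {ξ : ℕ → Bool} (hne : NonErasing σ)
    (hwm : WellMarked σ) (hprim : Primitive σ) (hfix : IsFixedPoint σ ξ)
    (hnp : ¬ UltPeriodic ξ) :
    ∃ L, ∀ W, StrongSpecial ξ W → L ≤ W.length → ∀ c d : Bool,
      ∃ n, (c :: W) <:+ subst σ (wordAt ξ 0 n) ∧ ξ n = d := by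
  obtain ⟨L, hL⟩ := exists_common_cut hne hwm hprim hfix hnp
  refine ⟨L, fun W hW hlen c d => ?_⟩
  obtain ⟨i, hi⟩ := hW c d
  obtain ⟨j, hj⟩ := hW c (!d)
  obtain ⟨hi1, hi2, hi3⟩ := occurrence_of_cons_append hi
  obtain ⟨-, hj2, hj3⟩ := occurrence_of_cons_append hj
  have heq := wordAt_eq_iff.1 (hi2.symm.trans hj2)
  obtain ⟨k, hk, hik, hjk⟩ := hL (i + 1) (j + 1) (fun k hk => heq k (by omega))
  obtain ⟨n, hn⟩ := mem_range_cut_of_common_cut hne hwm hfix (by omega : k ≤ W.length) heq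
    (by rw [hi3, hj3]; simp) hik hjk
  refine ⟨n, ⟨wordAt ξ 0 i, ?_⟩, ?_⟩
  · rw [subst_wordAt_zero hfix, hn, wordAt_add, wordAt_succ, zero_add, zero_add, ← hi2, hi1]
    simp
  · rw [← apply_cut hwm hfix n, hn, hi3]

/-- Desubstitution of two words that diverge just before `W`. -/
theorem exists_eq_T_of_suffix {σ : Bool → List Bool} (hne : NonErasing σ) {W0 : List Bool}
    {δ : Bool → Bool} (hW0 : W0Spec σ W0 δ) {u v W : List Bool} {c d : Bool} (hcd : c ≠ d)
    (hu : (c :: W) <:+ subst σ u) (hv : (d :: W) <:+ subst σ v) :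
    ∃ U x y, W = T σ W0 U ∧ δ x = c ∧ δ y = d ∧ (x :: U) <:+ u ∧ (y :: U) <:+ v := by
  have hnot : ∀ {u v : List Bool} {c d : Bool}, c ≠ d → (c :: W) <:+ subst σ u →
      (d :: W) <:+ subst σ v → ¬ u <:+ v := by
    rintro u v c d hcd hu hv ⟨t, rfl⟩
    rw [subst_append] at hv
    have h := (List.suffix_of_suffix_length_le (hu.trans (List.suffix_append _ _)) hv
      (by simp)).eq_of_length (by simp)
    simp at h
    exact hcd h
  obtain ⟨u', v', x, y, U, hxy, rfl, rfl⟩ :=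
    exists_common_suffix u v (hnot hcd hu hv) (hnot hcd.symm hv hu)
  have hδ : δ x ≠ δ y := by
    have h := hW0.1
    revert hxy
    cases x <;> cases y <;> simp [h, h.symm]
  have hx := cons_suffix_append_subst hne hW0 u' x U
  have hy := cons_suffix_append_subst hne hW0 v' y U
  have hu' := hu.trans (List.suffix_append W0 _)
  have hv' := hv.trans (List.suffix_append W0 _)
  obtain ⟨h1, h2⟩ := common_suffix_unique hδ hcd hx hy hu' hv'
  obtain ⟨-, h3⟩ := common_suffix_unique hδ.symm hcd.symm hy hx hv' hu'
  exact ⟨U, x, y, h1.symm, h2, h3, List.suffix_append _ _, List.suffix_append _ _⟩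

theorem T_injective {σ : Bool → List Bool} (hwm : WellMarked σ) (W0 : List Bool) :
    Function.Injective (T σ W0) := fun _ _ h => subst_injective hwm (List.append_cancel_left h)

end Subst

open Subst
/-- (i) `T` maps strong right special factors of `ξ` to strong right
special factors; (ii) there exists `L` such that every strong right special factor
`W` with `|W| ≥ L` equals `T(U)` for a unique strong right special factor `U`. -/
theorem statement15 (σ : Bool → List Bool) (hne : NonErasing σ)
    (hwm : WellMarked σ) (hprim : Primitive σ)
    (hAB : σ false ++ σ true ≠ σ true ++ σ false)
    (W0 : List Bool) (δ : Bool → Bool) (hW0 : W0Spec σ W0 δ)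
    (ξ : ℕ → Bool) (hfix : IsFixedPoint σ ξ) (hrec : Recurrent ξ)
    (hnp : ¬ UltPeriodic ξ) :
    (∀ W : List Bool, StrongSpecial ξ W → StrongSpecial ξ (T σ W0 W)) ∧
    (∃ L : ℕ, ∀ W : List Bool, StrongSpecial ξ W → L ≤ W.length →
        ∃! U : List Bool, StrongSpecial ξ U ∧ W = T σ W0 U) := by
  refine ⟨fun W hW => hW.image hne hwm hW0 hfix hrec, ?_⟩
  obtain ⟨L, hL⟩ := StrongSpecial.exists_cut hne hwm hprim hfix hnp
  refine ⟨L, fun W hW hlen => ?_⟩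
  choose n hsuf hnext using hL W hW hlen
  have hpair : ∀ c d, ∃ U x, W = T σ W0 U ∧ δ x = c ∧ (x :: U) <:+ wordAt ξ 0 (n c d) := by
    intro c d
    obtain ⟨U, x, y, h1, h2, -, h3, -⟩ :=
      exists_eq_T_of_suffix hne hW0 (by simp : c ≠ !c) (hsuf c d) (hsuf (!c) d)
    exact ⟨U, x, h1, h2, h3⟩
  obtain ⟨U, -, hU, -⟩ := hpair false false
  refine ⟨U, ⟨fun x d => ?_, hU⟩, fun V hV => T_injective hwm W0 (hV.2.symm.trans hU)⟩
  obtain ⟨V, y, hV, hy, t, ht⟩ := hpair (δ x) d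
  obtain rfl : V = U := T_injective hwm W0 (hV.symm.trans hU)
  have hyx : y = x := by
    have h := hW0.1
    revert hy
    cases x <;> cases y <;> simp [h, h.symm]
  subst hyx
  refine (isFactor_wordAt 0 (n (δ y) d + 1)).mono ⟨t, [], ?_⟩
  rw [wordAt_succ, ← ht, zero_add, hnext]
  simp
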